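/- Let p ≥ 5 be a prime. For all x, y ∈ p·M_d(Z_p), one has log(exp(x)·exp(y)) ≡ x + y mod p^{v_p(x)+v_p(y)}, where v_p denotes the minimal p-adic valuation of the matrix entries. -/

import Mathlib

/-- The `p`-adic matrix exponential, `exp x = ∑ xⁿ/n!`. -/
noncomputable def padicMatExp {d p : ℕ} [Fact p.Prime] (x : Matrix (Fin d) (Fin d) ℚ_[p]) :
    Matrix (Fin d) (Fin d) ℚ_[p] :=
  ∑' n : ℕ, ((Nat.factorial n : ℚ_[p]))⁻¹ • x ^ n

/-- The `p`-adic matrix logarithm, `log g = ∑ (-1)^(n-1) (g-1)ⁿ/n`. -/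
noncomputable def padicMatLog {d p : ℕ} [Fact p.Prime] (g : Matrix (Fin d) (Fin d) ℚ_[p]) :
    Matrix (Fin d) (Fin d) ℚ_[p] :=
  ∑' n : ℕ, (((-1 : ℚ_[p]) ^ n) / (n + 1 : ℚ_[p])) • (g - 1) ^ (n + 1)

open Filter Topology
open scoped Nat

section FactorialBounds

variable {p : ℕ} [Fact p.Prime]

theorem norm_inv_factorial_eq (n : ℕ) :
    ‖((n ! : ℚ_[p]))⁻¹‖ = (p : ℝ) ^ padicValNat p n ! := by
  have h : (n ! : ℚ_[p]) ≠ 0 := mod_cast n.factorial_ne_zero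
  rw [norm_inv, Padic.norm_eq_zpow_neg_valuation h, Padic.valuation_natCast, zpow_neg, inv_inv,
    zpow_natCast]

theorem four_mul_padicValNat_factorial_lt (hp : 5 ≤ p) {n : ℕ} (hn : n ≠ 0) :
    4 * padicValNat p n ! < n := by
  refine lt_of_le_of_lt ?_ (sub_one_mul_padicValNat_factorial_lt_of_ne_zero p hn)
  gcongr
  omega

theorem norm_inv_factorial_mul_inv_pow_le_one {n m : ℕ} (h : padicValNat p n ! ≤ m) :
    ‖((n ! : ℚ_[p]))⁻¹‖ * (p : ℝ)⁻¹ ^ m ≤ 1 := by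
  have hp1 : (1 : ℝ) ≤ p := mod_cast (Fact.out : p.Prime).one_lt.le
  rw [norm_inv_factorial_eq, inv_pow]
  exact mul_inv_le_one_of_le₀ (pow_le_pow_right₀ hp1 h) (by positivity)

theorem norm_inv_factorial_succ_mul_inv_pow_le_one (hp : 5 ≤ p) (n : ℕ) :
    ‖(((n + 1)! : ℚ_[p]))⁻¹‖ * (p : ℝ)⁻¹ ^ n ≤ 1 :=
  norm_inv_factorial_mul_inv_pow_le_one <| by
    have := four_mul_padicValNat_factorial_lt hp (Nat.add_one_ne_zero n)
    omega

theorem norm_inv_factorial_add_two_mul_inv_pow_le_one (hp : 5 ≤ p) (n : ℕ) :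
    ‖(((n + 2)! : ℚ_[p]))⁻¹‖ * (p : ℝ)⁻¹ ^ n ≤ 1 :=
  norm_inv_factorial_mul_inv_pow_le_one <| by
    have := four_mul_padicValNat_factorial_lt hp (show n + 2 ≠ 0 by omega)
    omega

theorem norm_inv_factorial_mul_inv_pow_le_half_pow (hp : 5 ≤ p) (n : ℕ) :
    ‖((n ! : ℚ_[p]))⁻¹‖ * (p : ℝ)⁻¹ ^ n ≤ (1 / 2) ^ n := by
  rcases eq_or_ne n 0 with rfl | hn
  · simp
  have hp5 : (5 : ℝ) ≤ p := mod_cast hp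
  have hv := four_mul_padicValNat_factorial_lt hp hn
  have hbase : (p : ℝ) ≤ (p / 2) ^ 4 := by
    have : (16 : ℝ) ≤ (p : ℝ) ^ 3 := by nlinarith [pow_le_pow_left₀ (by norm_num) hp5 3]
    nlinarith
  have hpow : (p : ℝ) ^ padicValNat p n ! ≤ (p / 2) ^ n :=
    calc (p : ℝ) ^ padicValNat p n ! ≤ ((p / 2) ^ 4) ^ padicValNat p n ! := by gcongr
      _ = (p / 2) ^ (4 * padicValNat p n !) := (pow_mul _ _ _).symm
      _ ≤ (p / 2) ^ n := pow_le_pow_right₀ (by linarith) hv.le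
  rw [norm_inv_factorial_eq]
  calc (p : ℝ) ^ padicValNat p n ! * (p : ℝ)⁻¹ ^ n ≤ (p / 2) ^ n * (p : ℝ)⁻¹ ^ n := by gcongr
    _ = (1 / 2) ^ n := by
      rw [← mul_pow]
      congr 1
      field_simp

theorem norm_inv_succ_le_norm_inv_factorial (n : ℕ) :
    ‖((n : ℚ_[p]) + 1)⁻¹‖ ≤ ‖(((n + 1)! : ℚ_[p]))⁻¹‖ := by
  have h : ((n : ℚ_[p]) + 1)⁻¹ = (n ! : ℚ_[p]) * (((n + 1)! : ℚ_[p]))⁻¹ := by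
    have : (n ! : ℚ_[p]) ≠ 0 := mod_cast n.factorial_ne_zero
    have : (n : ℚ_[p]) + 1 ≠ 0 := mod_cast n.succ_ne_zero
    rw [Nat.factorial_succ]
    push_cast
    field_simp
  rw [h, norm_mul]
  exact mul_le_of_le_one_left (norm_nonneg _) (mod_cast Padic.norm_int_le_one (p := p) (n ! : ℤ))

theorem choose_pred_div_succ_eq {N : ℕ} (hN : N ≠ 0) (n : ℕ) :
    ((N - 1).choose n : ℚ_[p]) / (n + 1) = (N : ℚ_[p])⁻¹ * N.choose (n + 1) := by
  obtain ⟨M, rfl⟩ := Nat.exists_eq_succ_of_ne_zero hN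
  have h1 : ((M.succ : ℕ) : ℚ_[p]) ≠ 0 := mod_cast hN
  have h2 : (n : ℚ_[p]) + 1 ≠ 0 := mod_cast n.succ_ne_zero
  have h := congrArg (Nat.cast : ℕ → ℚ_[p]) (Nat.add_one_mul_choose_eq M n)
  push_cast at h h1 ⊢
  rw [div_eq_iff h2, inv_mul_eq_div, div_mul_eq_mul_div, eq_div_iff h1, ← h]
  ring

theorem tendsto_prime_pow_cast : Tendsto (fun j : ℕ => ((p ^ j : ℕ) : ℚ_[p])) atTop (𝓝 0) := by
  push_cast
  exact tendsto_pow_atTop_nhds_zero_of_norm_lt_one Padic.norm_p_lt_one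

/-- As `N = p ^ j` tends to `0` in `ℚ_[p]`, the binomial coefficient `(N - 1).choose n` tends to
`(-1).choose n = (-1) ^ n`. -/
theorem tendsto_choose_prime_pow_pred (n : ℕ) :
    Tendsto (fun j : ℕ => ((p ^ j - 1).choose n : ℚ_[p])) atTop (𝓝 ((-1) ^ n)) := by
  induction n with
  | zero => simp
  | succ n ih =>
    have h : ∀ j : ℕ, ((p ^ j - 1).choose (n + 1) : ℚ_[p]) =
        ((p ^ j : ℕ) : ℚ_[p]) * (((p ^ j - 1).choose n : ℚ_[p]) / (n + 1))
          - (p ^ j - 1).choose n := by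
      intro j
      have hN : p ^ j ≠ 0 := pow_ne_zero _ (Fact.out : p.Prime).ne_zero
      have hN' : ((p ^ j : ℕ) : ℚ_[p]) ≠ 0 := mod_cast hN
      rw [choose_pred_div_succ_eq hN, mul_inv_cancel_left₀ hN', eq_sub_iff_add_eq', ← Nat.cast_add,
        ← Nat.choose_succ_succ, Nat.succ_eq_add_one, Nat.sub_add_cancel (Nat.pos_of_ne_zero hN)]
    simp_rw [h]
    convert (tendsto_prime_pow_cast.mul (ih.div_const _)).sub ih using 2
    ring

end FactorialBounds

section UltrametricRing

variable {A : Type*} [NormedRing A]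

theorem norm_pow_succ_le_of_le {x : A} {r s : ℝ} (hx : ‖x‖ ≤ r) (hr : r ≤ s) (n : ℕ) :
    ‖x ^ (n + 1)‖ ≤ s ^ n * r := by
  have hr0 : 0 ≤ r := (norm_nonneg x).trans hx
  calc ‖x ^ (n + 1)‖ ≤ ‖x‖ ^ (n + 1) := norm_pow_le' x n.succ_pos
    _ = ‖x‖ ^ n * ‖x‖ := pow_succ _ _
    _ ≤ s ^ n * r := mul_le_mul (pow_le_pow_left₀ (norm_nonneg _) (hx.trans hr) n) hx
      (norm_nonneg _) (pow_nonneg (hr0.trans hr) n)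

variable [IsUltrametricDist A]

theorem norm_add_le_of_ultrametric {x y : A} {r : ℝ} (hx : ‖x‖ ≤ r) (hy : ‖y‖ ≤ r) : ‖x + y‖ ≤ r :=
  (IsUltrametricDist.norm_add_le_max x y).trans (max_le hx hy)

theorem norm_pow_succ_sub_pow_succ_le {a b : A} {s : ℝ} (ha : ‖a‖ ≤ s) (hb : ‖b‖ ≤ s) (n : ℕ) :
    ‖a ^ (n + 1) - b ^ (n + 1)‖ ≤ s ^ n * ‖a - b‖ := by
  induction n with
  | zero => simp
  | succ n ih =>
    have h : a ^ (n + 2) - b ^ (n + 2) =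
        a * (a ^ (n + 1) - b ^ (n + 1)) + (a - b) * b ^ (n + 1) := by
      rw [pow_succ' a, pow_succ' b]
      noncomm_ring
    rw [h]
    refine norm_add_le_of_ultrametric ?_ ?_
    · calc ‖a * (a ^ (n + 1) - b ^ (n + 1))‖ ≤ s * (s ^ n * ‖a - b‖) := norm_mul_le_of_le ha ih
        _ = _ := by ring
    · calc ‖(a - b) * b ^ (n + 1)‖ ≤ ‖a - b‖ * (s ^ n * s) :=
          norm_mul_le_of_le le_rfl (norm_pow_succ_le_of_le hb le_rfl n)
        _ = _ := by ring

theorem norm_add_pow_sub_pow_sub_pow_le {x y : A} {r s t : ℝ} (hx : ‖x‖ ≤ r) (hy : ‖y‖ ≤ s)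
    (hr : r ≤ t) (hs : s ≤ t) (n : ℕ) :
    ‖(x + y) ^ (n + 2) - x ^ (n + 2) - y ^ (n + 2)‖ ≤ t ^ n * (r * s) := by
  have hx' : ∀ m, ‖x ^ (m + 1)‖ ≤ t ^ m * r := norm_pow_succ_le_of_le hx hr
  have hy' : ∀ m, ‖y ^ (m + 1)‖ ≤ t ^ m * s := norm_pow_succ_le_of_le hy hs
  have hcross : ∀ m, ‖x * y ^ (m + 1) + y * x ^ (m + 1)‖ ≤ t ^ m * (r * s) := fun m =>
    norm_add_le_of_ultrametric ((norm_mul_le_of_le hx (hy' m)).trans_eq (by ring))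
      ((norm_mul_le_of_le hy (hx' m)).trans_eq (by ring))
  induction n with
  | zero =>
    convert hcross 0 using 2
    noncomm_ring
  | succ n ih =>
    have h : (x + y) ^ (n + 3) - x ^ (n + 3) - y ^ (n + 3) =
        (x + y) * ((x + y) ^ (n + 2) - x ^ (n + 2) - y ^ (n + 2)) +
          (x * y ^ (n + 2) + y * x ^ (n + 2)) := by
      rw [pow_succ' (x + y) (n + 2), pow_succ' x (n + 2), pow_succ' y (n + 2)]
      generalize (x + y) ^ (n + 2) = a
      noncomm_ring
    rw [h]
    exact norm_add_le_of_ultrametric ((norm_mul_le_of_le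
      (norm_add_le_of_ultrametric (hx.trans hr) (hy.trans hs)) ih).trans_eq (by ring))
      (hcross (n + 1))

end UltrametricRing

section BanachAlgebra

variable (p : ℕ) [Fact p.Prime] {A : Type*} [NormedRing A] [NormedAlgebra ℚ_[p] A]

/-- The exponential series in a normed `ℚ_[p]`-algebra. -/
noncomputable def padicExpSum (x : A) : A :=
  ∑' n : ℕ, ((n ! : ℚ_[p]))⁻¹ • x ^ n

/-- The logarithm series in a normed `ℚ_[p]`-algebra. -/
noncomputable def padicLogSum (g : A) : A :=
  ∑' n : ℕ, (((-1 : ℚ_[p]) ^ n) / (n + 1 : ℚ_[p])) • (g - 1) ^ (n + 1)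

variable {p}

theorem norm_smul_pow_succ_le_half_pow (hp : 5 ≤ p) {x : A} (hx : ‖x‖ ≤ (p : ℝ)⁻¹) {n : ℕ}
    {c : ℚ_[p]} (hc : ‖c‖ ≤ ‖(((n + 1)! : ℚ_[p]))⁻¹‖) :
    ‖c • x ^ (n + 1)‖ ≤ (1 / 2) ^ (n + 1) :=
  calc ‖c • x ^ (n + 1)‖ ≤ ‖c‖ * ‖x ^ (n + 1)‖ := norm_smul_le _ _
    _ ≤ ‖(((n + 1)! : ℚ_[p]))⁻¹‖ * (p : ℝ)⁻¹ ^ (n + 1) := by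
      gcongr
      exact norm_pow_succ_le_of_le hx le_rfl n
    _ ≤ _ := norm_inv_factorial_mul_inv_pow_le_half_pow hp _

theorem summable_half_pow_succ : Summable fun n : ℕ => (1 / 2 : ℝ) ^ (n + 1) :=
  (summable_nat_add_iff 1).mpr summable_geometric_two

theorem summable_norm_exp_term (hp : 5 ≤ p) {x : A} (hx : ‖x‖ ≤ (p : ℝ)⁻¹) :
    Summable fun n : ℕ => ‖((n ! : ℚ_[p]))⁻¹ • x ^ n‖ :=
  (summable_nat_add_iff 1).mp <| summable_half_pow_succ.of_nonneg_of_le (fun _ => norm_nonneg _)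
    fun _ => norm_smul_pow_succ_le_half_pow hp hx le_rfl

theorem norm_log_coeff_le (n : ℕ) :
    ‖((-1 : ℚ_[p]) ^ n) / (n + 1 : ℚ_[p])‖ ≤ ‖(((n + 1)! : ℚ_[p]))⁻¹‖ := by
  rw [div_eq_mul_inv, norm_mul, norm_pow, norm_neg, norm_one, one_pow, one_mul]
  exact norm_inv_succ_le_norm_inv_factorial n

theorem padicExpSum_zero : padicExpSum p (0 : A) = 1 := by
  rw [padicExpSum, tsum_eq_single 0 fun n hn => by simp [hn]]
  simp

theorem norm_natCast_smul_le (N : ℕ) (x : A) : ‖(N : ℚ_[p]) • x‖ ≤ ‖x‖ :=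
  (norm_smul_le _ _).trans <|
    mul_le_of_le_one_left (norm_nonneg _) (mod_cast Padic.norm_int_le_one (p := p) (N : ℤ))

variable [CompleteSpace A]

theorem padicExpSum_eq_one_add (hp : 5 ≤ p) {x : A} (hx : ‖x‖ ≤ (p : ℝ)⁻¹) :
    padicExpSum p x = 1 + ∑' n : ℕ, (((n + 1)! : ℚ_[p]))⁻¹ • x ^ (n + 1) := by
  rw [padicExpSum, (summable_norm_exp_term hp hx).of_norm.tsum_eq_zero_add]
  simp

theorem padicExpSum_add_of_commute (hp : 5 ≤ p) {x y : A} (hxy : Commute x y)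
    (hx : ‖x‖ ≤ (p : ℝ)⁻¹) (hy : ‖y‖ ≤ (p : ℝ)⁻¹) :
    padicExpSum p (x + y) = padicExpSum p x * padicExpSum p y := by
  rw [padicExpSum, padicExpSum, padicExpSum,
    tsum_mul_tsum_eq_tsum_sum_antidiagonal_of_summable_norm
      (summable_norm_exp_term hp hx) (summable_norm_exp_term hp hy)]
  refine tsum_congr fun n => ?_
  rw [hxy.add_pow', Finset.smul_sum]
  refine Finset.sum_congr rfl fun kl hkl => ?_
  rw [← Nat.cast_smul_eq_nsmul ℚ_[p], smul_smul, smul_mul_smul_comm,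
    ← Finset.HasAntidiagonal.mem_antidiagonal.mp hkl, Nat.cast_add_choose, Finset.HasAntidiagonal.mem_antidiagonal.mp hkl]
  field_simp [n.factorial_ne_zero]

theorem padicExpSum_natCast_smul (hp : 5 ≤ p) {x : A} (hx : ‖x‖ ≤ (p : ℝ)⁻¹) (N : ℕ) :
    padicExpSum p ((N : ℚ_[p]) • x) = padicExpSum p x ^ N := by
  induction N with
  | zero => simp [padicExpSum_zero]
  | succ N ih =>
    rw [Nat.cast_succ, add_smul, one_smul, padicExpSum_add_of_commute hp
      ((Commute.refl x).smul_left _) ((norm_natCast_smul_le N x).trans hx) hx, ih, pow_succ]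

theorem tendsto_pow_sub_one_div_padicLogSum (hp : 5 ≤ p) {g : A} (hg : ‖g - 1‖ ≤ (p : ℝ)⁻¹) :
    Tendsto (fun j : ℕ => ((p ^ j : ℕ) : ℚ_[p])⁻¹ • (g ^ p ^ j - 1)) atTop
      (𝓝 (padicLogSum p g)) := by
  have hexp : ∀ j : ℕ, ((p ^ j : ℕ) : ℚ_[p])⁻¹ • (g ^ p ^ j - 1) =
      ∑' n : ℕ, (((p ^ j - 1).choose n : ℚ_[p]) / (n + 1)) • (g - 1) ^ (n + 1) := by
    intro j
    have hN : p ^ j ≠ 0 := pow_ne_zero _ (Fact.out : p.Prime).ne_zero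
    generalize p ^ j = N at hN
    have hbinom : g ^ N - 1 =
        ∑ n ∈ Finset.range N, (N.choose (n + 1) : ℚ_[p]) • (g - 1) ^ (n + 1) := by
      conv_lhs => rw [← sub_add_cancel g 1, (Commute.one_right (g - 1)).add_pow,
        Finset.sum_range_succ']
      simp [Nat.cast_smul_eq_nsmul, nsmul_eq_mul, (Nat.cast_commute _ _).eq]
    rw [hbinom, Finset.smul_sum, tsum_eq_sum (s := Finset.range N)]
    · exact Finset.sum_congr rfl fun n _ => by rw [choose_pred_div_succ_eq hN, smul_smul]
    · intro n hn
      rw [Finset.mem_range, not_lt] at hn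
      rw [Nat.choose_eq_zero_of_lt (by omega)]
      simp
  simp_rw [hexp]
  refine tendsto_tsum_of_dominated_convergence summable_half_pow_succ (fun n => ?_)
    (Eventually.of_forall fun j n => norm_smul_pow_succ_le_half_pow hp hg ?_)
  · exact ((tendsto_choose_prime_pow_pred n).div_const _).smul_const _
  · rw [div_eq_mul_inv, norm_mul]
    exact (mul_le_of_le_one_left (norm_nonneg _)
      (mod_cast Padic.norm_int_le_one (p := p) ((p ^ j - 1).choose n : ℤ))).trans
      (norm_inv_succ_le_norm_inv_factorial n)

theorem tendsto_padicExpSum_sub_one_div (hp : 5 ≤ p) {x : A} (hx : ‖x‖ ≤ (p : ℝ)⁻¹) :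
    Tendsto (fun j : ℕ => ((p ^ j : ℕ) : ℚ_[p])⁻¹ •
      (padicExpSum p (((p ^ j : ℕ) : ℚ_[p]) • x) - 1)) atTop (𝓝 x) := by
  have hexp : ∀ j : ℕ, ((p ^ j : ℕ) : ℚ_[p])⁻¹ •
      (padicExpSum p (((p ^ j : ℕ) : ℚ_[p]) • x) - 1) =
      ∑' n : ℕ, (((p ^ j : ℕ) : ℚ_[p]) ^ n * (((n + 1)! : ℚ_[p]))⁻¹) • x ^ (n + 1) := by
    intro j
    have hN : ((p ^ j : ℕ) : ℚ_[p]) ≠ 0 := mod_cast pow_ne_zero _ (Fact.out : p.Prime).ne_zero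
    rw [padicExpSum_eq_one_add hp ((norm_natCast_smul_le _ x).trans hx), add_sub_cancel_left,
      ← tsum_const_smul'']
    refine tsum_congr fun n => ?_
    rw [smul_pow, smul_smul, smul_smul, pow_succ]
    congr 1
    field_simp
  have hx_eq : x = ∑' n : ℕ, ((0 : ℚ_[p]) ^ n * (((n + 1)! : ℚ_[p]))⁻¹) • x ^ (n + 1) := by
    rw [tsum_eq_single 0 fun n hn => by simp [hn]]
    simp
  simp_rw [hexp]
  conv => enter [3, 1]; rw [hx_eq]
  refine tendsto_tsum_of_dominated_convergence summable_half_pow_succ (fun n => ?_)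
    (Eventually.of_forall fun j n => norm_smul_pow_succ_le_half_pow hp hx ?_)
  · exact ((tendsto_prime_pow_cast.pow n).mul_const _).smul_const _
  · rw [norm_mul, norm_pow]
    exact mul_le_of_le_one_left (norm_nonneg _) (pow_le_one₀ (norm_nonneg _)
      (mod_cast Padic.norm_int_le_one (p := p) (p ^ j : ℤ)))

variable [IsUltrametricDist A]

theorem norm_padicExpSum_sub_one_le (hp : 5 ≤ p) {x : A} {r : ℝ} (hx : ‖x‖ ≤ r)
    (hr : r ≤ (p : ℝ)⁻¹) : ‖padicExpSum p x - 1‖ ≤ r := by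
  have hr0 : 0 ≤ r := (norm_nonneg x).trans hx
  rw [padicExpSum_eq_one_add hp (hx.trans hr), add_sub_cancel_left]
  refine IsUltrametricDist.norm_tsum_le_of_forall_le_of_nonneg hr0 fun n => ?_
  calc ‖(((n + 1)! : ℚ_[p]))⁻¹ • x ^ (n + 1)‖
      ≤ ‖(((n + 1)! : ℚ_[p]))⁻¹‖ * ‖x ^ (n + 1)‖ := norm_smul_le _ _
    _ ≤ ‖(((n + 1)! : ℚ_[p]))⁻¹‖ * ((p : ℝ)⁻¹ ^ n * r) := by
      gcongr
      exact norm_pow_succ_le_of_le hx hr n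
    _ = (‖(((n + 1)! : ℚ_[p]))⁻¹‖ * (p : ℝ)⁻¹ ^ n) * r := (mul_assoc _ _ _).symm
    _ ≤ r := mul_le_of_le_one_left hr0 (norm_inv_factorial_succ_mul_inv_pow_le_one hp n)

/-- The logarithm inverts the exponential: both sides are the limit of
`(exp x ^ p ^ j - 1) / p ^ j = (exp (p ^ j • x) - 1) / p ^ j`. -/
theorem padicLogSum_padicExpSum (hp : 5 ≤ p) {x : A} (hx : ‖x‖ ≤ (p : ℝ)⁻¹) :
    padicLogSum p (padicExpSum p x) = x := by
  refine tendsto_nhds_unique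
    (tendsto_pow_sub_one_div_padicLogSum hp (norm_padicExpSum_sub_one_le hp hx le_rfl)) ?_
  simp_rw [← padicExpSum_natCast_smul hp hx]
  exact tendsto_padicExpSum_sub_one_div hp hx

theorem norm_padicLogSum_sub_le (hp : 5 ≤ p) {g h : A} (hg : ‖g - 1‖ ≤ (p : ℝ)⁻¹)
    (hh : ‖h - 1‖ ≤ (p : ℝ)⁻¹) : ‖padicLogSum p g - padicLogSum p h‖ ≤ ‖g - h‖ := by
  have hsum : ∀ {g : A}, ‖g - 1‖ ≤ (p : ℝ)⁻¹ →
      Summable fun n : ℕ => (((-1 : ℚ_[p]) ^ n) / (n + 1 : ℚ_[p])) • (g - 1) ^ (n + 1) :=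
    fun hg => summable_half_pow_succ.of_norm_bounded fun n =>
      norm_smul_pow_succ_le_half_pow hp hg (norm_log_coeff_le n)
  rw [padicLogSum, padicLogSum, ← (hsum hg).tsum_sub (hsum hh)]
  refine IsUltrametricDist.norm_tsum_le_of_forall_le_of_nonneg (norm_nonneg _) fun n => ?_
  rw [← smul_sub]
  calc _ ≤ ‖((-1 : ℚ_[p]) ^ n) / (n + 1 : ℚ_[p])‖ * ‖(g - 1) ^ (n + 1) - (h - 1) ^ (n + 1)‖ :=
        norm_smul_le _ _
    _ ≤ ‖(((n + 1)! : ℚ_[p]))⁻¹‖ * ((p : ℝ)⁻¹ ^ n * ‖(g - 1) - (h - 1)‖) := by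
      gcongr
      · exact norm_log_coeff_le n
      · exact norm_pow_succ_sub_pow_succ_le hg hh n
    _ = (‖(((n + 1)! : ℚ_[p]))⁻¹‖ * (p : ℝ)⁻¹ ^ n) * ‖g - h‖ := by
      rw [sub_sub_sub_cancel_right, mul_assoc]
    _ ≤ ‖g - h‖ := mul_le_of_le_one_left (norm_nonneg _)
      (norm_inv_factorial_succ_mul_inv_pow_le_one hp n)

theorem norm_padicExpSum_mul_sub_le (hp : 5 ≤ p) {x y : A} {r s : ℝ} (hx : ‖x‖ ≤ r)
    (hy : ‖y‖ ≤ s) (hr : r ≤ (p : ℝ)⁻¹) (hs : s ≤ (p : ℝ)⁻¹) :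
    ‖padicExpSum p x * padicExpSum p y - padicExpSum p (x + y)‖ ≤ r * s := by
  have hr0 : 0 ≤ r := (norm_nonneg x).trans hx
  have hs0 : 0 ≤ s := (norm_nonneg y).trans hy
  have hsum : ∀ {x : A}, ‖x‖ ≤ (p : ℝ)⁻¹ →
      HasSum (fun n : ℕ => ((n ! : ℚ_[p]))⁻¹ • x ^ n) (padicExpSum p x) :=
    fun hx => (summable_norm_exp_term hp hx).of_norm.hasSum
  have hxy : ‖x + y‖ ≤ (p : ℝ)⁻¹ := norm_add_le_of_ultrametric (hx.trans hr) (hy.trans hs)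
  have hdefect : HasSum (fun n : ℕ => (((n + 2)! : ℚ_[p]))⁻¹ •
      ((x + y) ^ (n + 2) - x ^ (n + 2) - y ^ (n + 2)))
      (padicExpSum p (x + y) - padicExpSum p x - padicExpSum p y + 1) := by
    have h := (hasSum_nat_add_iff' 2).mpr
      (((hsum hxy).sub (hsum (hx.trans hr))).sub (hsum (hy.trans hs)))
    simpa [Finset.sum_range_succ, smul_sub] using h
  have hle : ‖padicExpSum p (x + y) - padicExpSum p x - padicExpSum p y + 1‖ ≤ r * s := by
    rw [← hdefect.tsum_eq]
    refine IsUltrametricDist.norm_tsum_le_of_forall_le_of_nonneg (by positivity) fun n => ?_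
    calc _ ≤ ‖(((n + 2)! : ℚ_[p]))⁻¹‖ * ‖(x + y) ^ (n + 2) - x ^ (n + 2) - y ^ (n + 2)‖ :=
          norm_smul_le _ _
      _ ≤ ‖(((n + 2)! : ℚ_[p]))⁻¹‖ * ((p : ℝ)⁻¹ ^ n * (r * s)) := by
        gcongr
        exact norm_add_pow_sub_pow_sub_pow_le hx hy hr hs n
      _ = (‖(((n + 2)! : ℚ_[p]))⁻¹‖ * (p : ℝ)⁻¹ ^ n) * (r * s) := (mul_assoc _ _ _).symm
      _ ≤ r * s := mul_le_of_le_one_left (by positivity)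
        (norm_inv_factorial_add_two_mul_inv_pow_le_one hp n)
  have hsplit : padicExpSum p x * padicExpSum p y - padicExpSum p (x + y) =
      (padicExpSum p x - 1) * (padicExpSum p y - 1) +
        -(padicExpSum p (x + y) - padicExpSum p x - padicExpSum p y + 1) := by
    noncomm_ring
  rw [hsplit]
  refine norm_add_le_of_ultrametric (norm_mul_le_of_le (norm_padicExpSum_sub_one_le hp hx hr)
    (norm_padicExpSum_sub_one_le hp hy hs)) ?_
  rwa [norm_neg]

theorem norm_padicLogSum_exp_mul_exp_sub_add_le (hp : 5 ≤ p) {x y : A} {r s : ℝ} (hx : ‖x‖ ≤ r)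
    (hy : ‖y‖ ≤ s) (hr : r ≤ (p : ℝ)⁻¹) (hs : s ≤ (p : ℝ)⁻¹) :
    ‖padicLogSum p (padicExpSum p x * padicExpSum p y) - (x + y)‖ ≤ r * s := by
  have hxy : ‖x + y‖ ≤ (p : ℝ)⁻¹ := norm_add_le_of_ultrametric (hx.trans hr) (hy.trans hs)
  have hdiff := norm_padicExpSum_mul_sub_le hp hx hy hr hs
  have hexp := norm_padicExpSum_sub_one_le hp hxy le_rfl
  have hp1 : (p : ℝ)⁻¹ ≤ 1 := inv_le_one_of_one_le₀ (mod_cast (by omega : 1 ≤ p))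
  have hrs : r * s ≤ (p : ℝ)⁻¹ :=
    (mul_le_of_le_one_left ((norm_nonneg y).trans hy) (hr.trans hp1)).trans hs
  have hprod : ‖padicExpSum p x * padicExpSum p y - 1‖ ≤ (p : ℝ)⁻¹ := by
    rw [← sub_add_sub_cancel _ (padicExpSum p (x + y)) 1]
    exact norm_add_le_of_ultrametric (hdiff.trans hrs) hexp
  have h := (norm_padicLogSum_sub_le hp hprod hexp).trans hdiff
  rwa [padicLogSum_padicExpSum hp hxy] at h

end BanachAlgebra

section MatrixNorm

variable (d p : ℕ) [Fact p.Prime]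

attribute [local instance] Matrix.normedAddCommGroup

/-- Over `ℚ_[p]` the entrywise sup norm on square matrices is submultiplicative. -/
noncomputable abbrev padicMatrixNormedRing : NormedRing (Matrix (Fin d) (Fin d) ℚ_[p]) :=
  { Matrix.normedAddCommGroup, (inferInstance : Ring (Matrix (Fin d) (Fin d) ℚ_[p])) with
    norm_mul_le := fun a b => by
      refine (Matrix.norm_le_iff (by positivity)).mpr fun i j => ?_
      rw [Matrix.mul_apply]
      refine IsUltrametricDist.norm_sum_le_of_forall_le_of_nonneg (by positivity) fun k _ => ?_
      exact norm_mul_le_of_le (Matrix.norm_entry_le_entrywise_sup_norm a)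
        (Matrix.norm_entry_le_entrywise_sup_norm b) }

/-- The normed algebra structure over `ℚ_[p]` for the entrywise sup norm on square matrices. -/
noncomputable abbrev padicMatrixNormedAlgebra :
    letI := padicMatrixNormedRing d p
    NormedAlgebra ℚ_[p] (Matrix (Fin d) (Fin d) ℚ_[p]) :=
  letI := padicMatrixNormedRing d p
  { (inferInstance : Algebra ℚ_[p] (Matrix (Fin d) (Fin d) ℚ_[p])) with
    norm_smul_le := fun a b =>
      norm_smul_le (β := Fin d → Fin d → ℚ_[p]) a b }

theorem padicMatrix_completeSpace :
    letI := padicMatrixNormedRing d p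
    @CompleteSpace (Matrix (Fin d) (Fin d) ℚ_[p]) PseudoMetricSpace.toUniformSpace :=
  inferInstanceAs (CompleteSpace (Fin d → Fin d → ℚ_[p]))

end MatrixNorm

theorem zpow_neg_natCast_le_inv {p : ℕ} (hp : 5 ≤ p) {k : ℕ} (hk : 1 ≤ k) :
    (p : ℝ) ^ (-(k : ℤ)) ≤ (p : ℝ)⁻¹ := by
  rw [← zpow_neg_one]
  exact zpow_le_zpow_right₀ (mod_cast (by omega : 1 ≤ p)) (by omega)

/-- For a prime `p ≥ 5` and matrices `x, y ∈ p·M_d(ℤ_p)` (i.e. all entries of valuation at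
least `k`, resp. `l`, with `k, l ≥ 1`), one has
`log(exp(x)·exp(y)) ≡ x + y mod p^(v_p(x) + v_p(y))`. -/
theorem padic_log_exp_mul_exp_congruent (d p : ℕ) [Fact p.Prime] (hp : 5 ≤ p)
    (x y : Matrix (Fin d) (Fin d) ℚ_[p]) (k l : ℕ) (hk : 1 ≤ k) (hl : 1 ≤ l)
    (hx : ∀ i j, ‖x i j‖ ≤ (p : ℝ) ^ (-(k : ℤ)))
    (hy : ∀ i j, ‖y i j‖ ≤ (p : ℝ) ^ (-(l : ℤ))) :
    ∀ i j, ‖(padicMatLog (padicMatExp x * padicMatExp y) - (x + y)) i j‖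
      ≤ (p : ℝ) ^ (-((k : ℤ) + (l : ℤ))) := by
  let := padicMatrixNormedRing d p
  let := padicMatrixNormedAlgebra d p
  have := padicMatrix_completeSpace d p
  have : IsUltrametricDist (Matrix (Fin d) (Fin d) ℚ_[p]) :=
    inferInstanceAs (IsUltrametricDist (Fin d → Fin d → ℚ_[p]))
  have hp0 : (p : ℝ) ≠ 0 := mod_cast (by omega : p ≠ 0)
  have hnorm := norm_padicLogSum_exp_mul_exp_sub_add_le hp
    ((Matrix.norm_le_iff (by positivity)).mpr hx) ((Matrix.norm_le_iff (by positivity)).mpr hy)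
    (zpow_neg_natCast_le_inv hp hk) (zpow_neg_natCast_le_inv hp hl)
  rw [← zpow_add₀ hp0, ← neg_add] at hnorm
  exact (Matrix.norm_le_iff (by positivity)).mp hnorm
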